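/- Let k, θ_B, θ_E, γ̄_B, γ̄_E be positive reals and R_S ≥ 0. Then ∫₀^∞ [Υ(k, 2^{R_S} x/(γ̄_B θ_B))/Γ(k)] · (1/(γ̄_E θ_E)) e^{−x/(γ̄_E θ_E)} dx = (u/(1+u))^k, where u = 2^{R_S} γ̄_E θ_E/(γ̄_B θ_B). (This is the secrecy outage probability lower bound SOP_L of Proposition 3, since the paper's expression (γ̄_EθE/(γ̄_BθB))^k · 2^{k R_S}/(k·B(k,1)) · ₂F₁(k+1,k;1+k;−u) reduces to (u/(1+u))^k via B(k,1)=1/k and ₂F₁(k+1,k;1+k;z)=(1−z)^{−k}.) -/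

import Mathlib

open MeasureTheory Real

noncomputable section

/-- Lower incomplete gamma function `Υ(k, x) = ∫₀^x t^(k-1) e^(-t) dt`. -/
def lowerIncGamma (k x : ℝ) : ℝ := ∫ t in (0:ℝ)..x, t ^ (k - 1) * Real.exp (-t)

theorem intervalIntegrable_rpow_mul_exp_neg {k : ℝ} (hk : 0 < k) (a b : ℝ) :
    IntervalIntegrable (fun t : ℝ => t ^ (k - 1) * Real.exp (-t)) volume a b :=
  (intervalIntegral.intervalIntegrable_rpow' (by linarith)).mul_continuousOn
    (Continuous.continuousOn (by fun_prop))

theorem integrableOn_rpow_mul_exp_neg {k : ℝ} (hk : 0 < k) :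
    IntegrableOn (fun t : ℝ => t ^ (k - 1) * Real.exp (-t)) (Set.Ioi 0) := by
  simpa only [mul_comm] using Real.GammaIntegral_convergent hk

theorem continuous_lowerIncGamma {k : ℝ} (hk : 0 < k) : Continuous (lowerIncGamma k) :=
  intervalIntegral.continuous_primitive (intervalIntegrable_rpow_mul_exp_neg hk) 0

theorem hasDerivAt_lowerIncGamma {k x : ℝ} (hk : 0 < k) (hx : 0 < x) :
    HasDerivAt (lowerIncGamma k) (x ^ (k - 1) * Real.exp (-x)) x := by
  refine intervalIntegral.integral_hasDerivAt_right
    (intervalIntegrable_rpow_mul_exp_neg hk 0 x) ?_ ?_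
  · exact (by fun_prop : Measurable fun t : ℝ => t ^ (k - 1) * Real.exp (-t))
      |>.stronglyMeasurable.stronglyMeasurableAtFilter
  · exact (Real.continuousAt_rpow_const _ _ (Or.inl hx.ne')).mul (by fun_prop)

theorem tendsto_lowerIncGamma_atTop {k : ℝ} (hk : 0 < k) :
    Filter.Tendsto (lowerIncGamma k) Filter.atTop (nhds (Real.Gamma k)) := by
  rw [Real.Gamma_eq_integral hk]
  simp only [mul_comm (Real.exp _)]
  exact intervalIntegral_tendsto_integral_Ioi 0 (integrableOn_rpow_mul_exp_neg hk)
    Filter.tendsto_id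

theorem lowerIncGamma_nonneg (k : ℝ) {x : ℝ} (hx : 0 ≤ x) : 0 ≤ lowerIncGamma k x :=
  intervalIntegral.integral_nonneg hx fun _ ht =>
    mul_nonneg (Real.rpow_nonneg ht.1 _) (Real.exp_nonneg _)

theorem lowerIncGamma_le_Gamma {k x : ℝ} (hk : 0 < k) (hx : 0 ≤ x) :
    lowerIncGamma k x ≤ Real.Gamma k := by
  rw [Real.Gamma_eq_integral hk, lowerIncGamma, intervalIntegral.integral_of_le hx]
  simp only [mul_comm (Real.exp _)]
  refine setIntegral_mono_set (integrableOn_rpow_mul_exp_neg hk) ?_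
    (Filter.Eventually.of_forall fun _ ht => ht.1)
  filter_upwards [ae_restrict_mem measurableSet_Ioi] with t ht
  exact mul_nonneg (Real.rpow_nonneg (le_of_lt ht) _) (Real.exp_nonneg _)

/-- The Laplace transform of the lower incomplete gamma function. -/
theorem integral_lowerIncGamma_mul_exp {k s : ℝ} (hk : 0 < k) (hs : 0 < s) :
    ∫ x in Set.Ioi (0:ℝ), lowerIncGamma k x * (s * Real.exp (-(s * x))) =
      (1 / (1 + s)) ^ k * Real.Gamma k := by
  have hexp : IntegrableOn (fun x : ℝ => s * Real.exp (-(s * x))) (Set.Ioi 0) := by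
    simpa only [neg_mul, IntegrableOn] using (integrableOn_exp_mul_Ioi (neg_lt_zero.mpr hs) 0).const_mul s
  have hprod (x : ℝ) : x ^ (k - 1) * Real.exp (-x) * -Real.exp (-(s * x)) =
      -(x ^ (k - 1) * Real.exp (-((1 + s) * x))) := by
    rw [mul_neg, mul_assoc, ← Real.exp_add]
    ring_nf
  have hgamma := Real.integral_rpow_mul_exp_neg_mul_Ioi hk (by positivity : 0 < 1 + s)
  have hGpos := Real.Gamma_pos_of_pos hk
  have hparts := integral_Ioi_mul_deriv_eq_deriv_mul (a := (0 : ℝ)) (a' := 0) (b' := 0)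
    (u := lowerIncGamma k) (u' := fun x => x ^ (k - 1) * Real.exp (-x))
    (v := fun x => -Real.exp (-(s * x))) (v' := fun x => s * Real.exp (-(s * x)))
    (fun x hx => hasDerivAt_lowerIncGamma hk hx)
    (fun x _ => by
      convert! (((hasDerivAt_id x).const_mul s).neg.exp).neg using 1
      simp [mul_comm])
    (by
      refine hexp.bdd_mul (c := Real.Gamma k)
        (continuous_lowerIncGamma hk).aestronglyMeasurable ?_
      filter_upwards [ae_restrict_mem measurableSet_Ioi] with x hx
      rw [Real.norm_of_nonneg (lowerIncGamma_nonneg k (le_of_lt hx))]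
      exact lowerIncGamma_le_Gamma hk (le_of_lt hx))
    (by
      simp only [Pi.mul_def, hprod]
      exact Integrable.neg (.of_integral_ne_zero (by rw [hgamma]; positivity)))
    (by
      have hcont : Continuous (lowerIncGamma k * fun x => -Real.exp (-(s * x))) :=
        (continuous_lowerIncGamma hk).mul (by fun_prop)
      have h := hcont.tendsto 0
      simp only [Pi.mul_apply, lowerIncGamma, intervalIntegral.integral_same, zero_mul] at h
      exact h.mono_left nhdsWithin_le_nhds)
    (by
      have h : Filter.Tendsto (fun x : ℝ => -Real.exp (-(s * x))) Filter.atTop (nhds (-0)) :=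
        (Real.tendsto_exp_neg_atTop_nhds_zero.comp
          (Filter.tendsto_id.const_mul_atTop hs)).neg
      simpa only [neg_zero, mul_zero] using! (tendsto_lowerIncGamma_atTop hk).mul h)
  rw [hparts]
  simp only [hprod, integral_neg, hgamma]
  ring

/-- Proposition 3, closed form: the SOP lower bound
`∫₀^∞ [Υ(k, 2^{R_S} x/(γ̄_B θ_B))/Γ(k)] · (1/(γ̄_E θ_E)) e^{−x/(γ̄_E θ_E)} dx`
equals `(u/(1+u))^k` with `u = 2^{R_S} γ̄_E θ_E/(γ̄_B θ_B)`. -/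
theorem sop_lower_bound_closed_form
    (k θB θE γB γE RS : ℝ) (hk : 0 < k) (hθB : 0 < θB) (hθE : 0 < θE)
    (hγB : 0 < γB) (hγE : 0 < γE) (hRS : 0 ≤ RS)
    (u : ℝ) (hu : u = (2:ℝ) ^ RS * γE * θE / (γB * θB)) :
    (∫ x in Set.Ioi (0:ℝ),
        (lowerIncGamma k ((2:ℝ) ^ RS * x / (γB * θB)) / Real.Gamma k) *
          ((1 / (γE * θE)) * Real.exp (-x / (γE * θE)))) =
      (u / (1 + u)) ^ k := by
  have hu_pos : 0 < u := by rw [hu]; positivity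
  have hGpos := Real.Gamma_pos_of_pos hk
  have hc : 0 < (2:ℝ) ^ RS / (γB * θB) := by positivity
  set c := (2:ℝ) ^ RS / (γB * θB) with hc_def
  have huc : u = c * (γE * θE) := by rw [hu, hc_def]; ring
  have hscale (x : ℝ) :
      (lowerIncGamma k ((2:ℝ) ^ RS * x / (γB * θB)) / Real.Gamma k) *
          ((1 / (γE * θE)) * Real.exp (-x / (γE * θE))) =
        (c / Real.Gamma k) *
          (lowerIncGamma k (c * x) * (1 / u * Real.exp (-(1 / u * (c * x))))) := by
    have harg : (2:ℝ) ^ RS * x / (γB * θB) = c * x := by rw [hc_def]; ring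
    have hexp : -x / (γE * θE) = -(1 / u * (c * x)) := by rw [huc]; field_simp
    have hcoef : 1 / (γE * θE) = c * (1 / u) := by rw [huc]; field_simp
    rw [harg, hexp, hcoef]
    ring
  simp only [hscale]
  rw [integral_const_mul, integral_comp_mul_left_Ioi
    (fun y => lowerIncGamma k y * (1 / u * Real.exp (-(1 / u * y)))) 0 hc, mul_zero,
    integral_lowerIncGamma_mul_exp hk (by positivity : 0 < 1 / u), smul_eq_mul]
  have hbase : 1 / (1 + 1 / u) = u / (1 + u) := by field_simp; ring
  rw [hbase]
  field_simp

end
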